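/- Suppose in addition that Ω is twice continuously differentiable. Let μ be an Ahlfors 1-regular, Ω-symmetric measure on ℂ. Then the support of μ is contained in an affine line L ⊂ ℂ. -/

import Mathlib

open MeasureTheory Metric Complex Filter Set
open scoped Topology ENNReal NNReal

noncomputable section

/-- The real inner product on `ℂ ≅ ℝ²`. -/
def rinner (u v : ℂ) : ℝ := u.re * v.re + u.im * v.im

/-- The geodesic distance on the unit circle `𝕊 ⊂ ℂ`. -/
def dS (u v : ℂ) : ℝ := Real.arccos (rinner u v)

/-- The kernel `K(x) = |x| Ω(x/|x|)` (with `K 0 = 0`). -/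
def Kmap (Ω : ℂ → ℂ) (x : ℂ) : ℂ := (‖x‖ : ℂ) * Ω (x / (‖x‖ : ℂ))

/-- The support of a measure on `ℂ`. -/
def spt (μ : Measure ℂ) : Set ℂ := {x : ℂ | ∀ r : ℝ, 0 < r → 0 < μ (ball x r)}

/-- Ahlfors 1-regularity with constant `C₀`. -/
def Ahlfors1 (μ : Measure ℂ) (C₀ : ℝ) : Prop :=
  ∀ x ∈ spt μ, ∀ r : ℝ, 0 < r →
    ENNReal.ofReal (C₀⁻¹ * r) ≤ μ (ball x r) ∧ μ (ball x r) ≤ ENNReal.ofReal (C₀ * r)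

/-- `Ω`-symmetry of a measure. -/
def OmegaSym (Ω : ℂ → ℂ) (μ : Measure ℂ) : Prop :=
  ∀ x ∈ spt μ, ∀ r : ℝ, 0 < r → (∫ y in ball x r, Kmap Ω (x - y) ∂μ) = 0

/-- `Ω` maps the unit circle to itself. -/
def MapsCircle (Ω : ℂ → ℂ) : Prop := ∀ u : ℂ, ‖u‖ = 1 → ‖Ω u‖ = 1

/-- `Ω` is odd on the unit circle. -/
def OddOnCircle (Ω : ℂ → ℂ) : Prop := ∀ u : ℂ, ‖u‖ = 1 → Ω (-u) = -(Ω u)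

/-- `Ω` is bi-Lipschitz with constant `1 + δ` on the circle, w.r.t. geodesic distance. -/
def BiLipOnCircle (Ω : ℂ → ℂ) (δ : ℝ) : Prop :=
  ∀ u v : ℂ, ‖u‖ = 1 → ‖v‖ = 1 →
    (1 + δ)⁻¹ * dS u v ≤ dS (Ω u) (Ω v) ∧ dS (Ω u) (Ω v) ≤ (1 + δ) * dS u v

/-- `Ω` is `C^k` as a circle map: it has a `C^k` lift `ω`. -/
def CircleCk (Ω : ℂ → ℂ) (k : ℕ) : Prop :=
  ∃ ω : ℝ → ℝ, ContDiff ℝ k ω ∧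
    ∀ t : ℝ, Ω (Complex.exp ((t : ℂ) * Complex.I)) = Complex.exp ((ω t : ℂ) * Complex.I)

/-- Affine lines in `ℂ`. -/
def IsLine (L : Set ℂ) : Prop :=
  ∃ a b : ℂ, b ≠ 0 ∧ L = {z : ℂ | ∃ t : ℝ, z = a + t • b}

lemma hasDerivAt_posSq (u : ℝ) : HasDerivAt (fun u : ℝ => (max u 0)^2) (2 * max u 0) u := by
  rcases lt_trichotomy u 0 with h | h | h
  · have : (fun u : ℝ => (max u 0)^2) =ᶠ[𝓝 u] fun _ => 0 := by
      filter_upwards [Iio_mem_nhds h] with v hv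
      simp [max_eq_right ((mem_Iio.1 hv).le)]
    rw [max_eq_right h.le, mul_zero]
    exact (hasDerivAt_const u (0:ℝ)).congr_of_eventuallyEq this
  · subst h
    rw [hasDerivAt_iff_isLittleO_nhds_zero]
    simp only [zero_add, max_self, mul_zero, smul_zero, sub_zero, ne_eq, OfNat.ofNat_ne_zero, not_false_eq_true, zero_pow]
    have : (fun h : ℝ => (max h 0)^2) =O[𝓝 0] fun h : ℝ => h^2 := by
      refine Asymptotics.IsBigO.of_bound 1 (Eventually.of_forall fun h => ?_)
      simp only [norm_pow, Real.norm_eq_abs, one_mul]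
      refine pow_le_pow_left₀ (abs_nonneg _) ?_ 2
      rw [abs_of_nonneg (le_max_right _ _)]
      exact max_le (le_abs_self _) (abs_nonneg _)
    exact this.trans_isLittleO (Asymptotics.isLittleO_pow_id (by norm_num))
  · have : (fun u : ℝ => (max u 0)^2) =ᶠ[𝓝 u] fun u => u^2 := by
      filter_upwards [Ioi_mem_nhds h] with v hv
      simp [max_eq_left ((mem_Ioi.1 hv).le)]
    rw [max_eq_left h.le]
    refine HasDerivAt.congr_of_eventuallyEq ?_ this
    simpa using hasDerivAt_pow 2 u

lemma phi_exists (ε : ℝ) (hε : 0 < ε) : ∃ (M E : ℝ) (φ : ℝ → ℝ), 1 ≤ M ∧ 0 ≤ E ∧ E * M ≤ ε ∧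
    ContDiff ℝ 1 φ ∧ (∀ s, M^2 ≤ s → φ s = 0) ∧ (∀ s, 0 ≤ s → 0 ≤ φ s) ∧ (∀ s, 0 ≤ s → φ s ≤ 1) ∧
    (∀ s, 0 ≤ s → s ≤ 1 → 1/8 ≤ φ s) ∧ ∀ s, 0 ≤ s → -E ≤ 3/2 * φ s + 2 * s * deriv φ s := by
  obtain ⟨N, hn⟩ := exists_gt (max 2 (4/ε))
  have hn2 : (2:ℝ) < N := lt_of_le_of_lt (le_max_left _ _) hn
  have hnε : 4/ε < N := lt_of_le_of_lt (le_max_right _ _) hn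
  have hn0 : (0:ℝ) < N := by linarith
  set Q : ℝ := N^4 with hQ
  have hQ16 : 16 ≤ Q := by
    rw [hQ]; nlinarith [sq_nonneg (N^2 - 4), mul_pos hn0 hn0]
  have hQ0 : 0 < Q := by linarith
  let p : ℝ → ℝ := fun s => (1 + s^2)^(-(3/8) : ℝ)
  let p' : ℝ → ℝ := fun s => (2 * s) * (-(3/8)) * (1 + s^2)^(-(3/8) - 1 : ℝ)
  let c : ℝ → ℝ := fun s => (max (1 - s/Q) 0)^2
  let c' : ℝ → ℝ := fun s => 2 * max (1 - s/Q) 0 * (-(1/Q))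
  have hpos : ∀ s : ℝ, 0 < 1 + s^2 := fun s => by positivity
  have hp : ∀ s, HasDerivAt p (p' s) s := fun s => by
    have h1 : HasDerivAt (fun s : ℝ => 1 + s^2) (2*s) s := by
      simpa using (hasDerivAt_pow 2 s).const_add 1
    exact h1.rpow_const (Or.inl (hpos s).ne')
  have hc : ∀ s, HasDerivAt c (c' s) s := fun s => by
    have h1 : HasDerivAt (fun s : ℝ => 1 - s/Q) (-(1/Q)) s := by
      simpa using ((hasDerivAt_id s).div_const Q).const_sub 1
    exact (hasDerivAt_posSq (1 - s/Q)).comp s h1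
  have hφ : ∀ s, HasDerivAt (fun s => p s * c s) (p' s * c s + p s * c' s) s := fun s => (hp s).mul (hc s)
  have hp_le : ∀ s, p s ≤ 1 := fun s =>
    Real.rpow_le_one_of_one_le_of_nonpos (by nlinarith [sq_nonneg s]) (by norm_num)
  have hp0 : ∀ s, 0 < p s := fun s => Real.rpow_pos_of_pos (hpos s) _
  have hc0 : ∀ s, 0 ≤ c s := fun s => sq_nonneg _
  have hp'eq : ∀ s, p' s * (1 + s^2) = -(3/4) * s * p s := fun s => by
    simp only [p', p]
    rw [Real.rpow_sub_one (hpos s).ne']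
    field_simp
    ring
  refine ⟨N^2, 4/N^3, fun s => p s * c s, by nlinarith, by positivity, ?_, ?_, ?_, ?_, ?_, ?_, ?_⟩
  · have : 4/N^3*N^2 = 4/N := by field_simp
    rw [this, div_le_iff₀ hn0]
    rw [div_lt_iff₀ hε] at hnε; linarith
  · rw [contDiff_one_iff_deriv]
    refine ⟨fun s => (hφ s).differentiableAt, ?_⟩
    have : deriv (fun s => p s * c s) = fun s => (p' s * c s + p s * c' s) := funext fun s => (hφ s).deriv
    rw [this]
    have c1 : Continuous p := continuous_iff_continuousAt.2 fun s => (hp s).continuousAt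
    have c2 : Continuous c := continuous_iff_continuousAt.2 fun s => (hc s).continuousAt
    have c3 : Continuous p' := by
      refine Continuous.mul (by fun_prop) (Continuous.rpow_const (by fun_prop) fun s => Or.inl (hpos s).ne')
    have c4 : Continuous c' := by fun_prop
    fun_prop
  · intro s hs
    have : 1 - s/Q ≤ 0 := by
      have : 1 ≤ s/Q := by rw [le_div_iff₀ hQ0, hQ]; nlinarith
      linarith
    simp [c, max_eq_right this]
  · intro s _; exact mul_nonneg (hp0 s).le (hc0 s)
  · intro s hs
    have h1 : c s ≤ 1 := by
      have : max (1 - s/Q) 0 ≤ 1 := max_le (by have := div_nonneg hs hQ0.le; linarith) zero_le_one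
      exact pow_le_one₀ (le_max_right _ _) this
    exact mul_le_one₀ (hp_le s) (hc0 s) h1
  · intro s hs hs1
    have h1 : 1/4 ≤ c s := by
      have : 1/2 ≤ max (1 - s/Q) 0 := le_max_of_le_left (by
        have : s/Q ≤ 1/2 := by rw [div_le_iff₀ hQ0]; linarith
        linarith)
      simp only [c]; nlinarith
    have h2 : 1/2 ≤ p s := by
      have e1 : (2:ℝ)^(-(3/8):ℝ) ≤ p s :=
        Real.rpow_le_rpow_of_nonpos (hpos s) (by nlinarith) (by norm_num)
      have e2 : (2:ℝ)^(-1:ℝ) ≤ (2:ℝ)^(-(3/8):ℝ) :=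
        Real.rpow_le_rpow_of_exponent_le (by norm_num) (by norm_num)
      rw [Real.rpow_neg_one] at e2
      linarith
    show 1/8 ≤ p s * c s
    nlinarith
  · intro s hs
    rw [(hφ s).deriv]
    have e1 : 0 ≤ 3/2 * p s + 2 * s * p' s := by
      have : (3/2 * p s + 2 * s * p' s) * (1+s^2) = 3/2 * p s := by
        have := hp'eq s
        linear_combination (2*s) * this
      by_contra hneg
      push Not at hneg
      nlinarith [hp0 s, hpos s]
    have e2 : s * p s ≤ N ∨ Q ≤ s := by
      by_cases h : Q ≤ s
      · exact Or.inr h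
      · left
        push Not at h
        rcases hs.eq_or_lt with h0 | h0
        · rw [← h0]; simp; exact hn0.le
        have a1 : p s ≤ s^(-(3/4):ℝ) := by
          have : s^(-(3/4):ℝ) = (s^2)^(-(3/8):ℝ) := by
            rw [← Real.rpow_natCast, ← Real.rpow_mul hs]; norm_num
          rw [this]
          exact Real.rpow_le_rpow_of_nonpos (by positivity) (by linarith) (by norm_num)
        have a2 : s * s^(-(3/4):ℝ) = s^(1/4:ℝ) := by
          nth_rewrite 1 [← Real.rpow_one s]
          rw [← Real.rpow_add h0]; norm_num
        have a3 : s^(1/4:ℝ) ≤ Q^(1/4:ℝ) := Real.rpow_le_rpow hs h.le (by norm_num)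
        have a4 : Q^(1/4:ℝ) = N := by
          rw [hQ, ← Real.rpow_natCast, ← Real.rpow_mul hn0.le]; norm_num
        calc s * p s ≤ s * s^(-(3/4):ℝ) := by gcongr
          _ ≤ N := by rw [a2, ← a4]; exact a3
    have e3 : -(4/N^3) ≤ 2 * s * (p s * c' s) := by
      rcases e2 with h | h
      · set m := max (1 - s/Q) 0 with hm
        have m0 : 0 ≤ m := le_max_right _ _
        have m1 : m ≤ 1 := max_le (by have := div_nonneg hs hQ0.le; linarith) zero_le_one
        have : 2 * s * (p s * c' s) = -(4 / Q * (m * (s * p s))) := by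
          simp only [c', ← hm]; ring
        rw [this]
        have h4 : m * (s * p s) ≤ N := by
          have := mul_nonneg hs (hp0 s).le
          nlinarith
        have h5 : 4/Q * N = 4/N^3 := by rw [hQ]; field_simp
        have : 4 / Q * (m * (s * p s)) ≤ 4/Q * N := by gcongr
        linarith
      · have : 1 - s/Q ≤ 0 := by
          have : 1 ≤ s/Q := by rw [le_div_iff₀ hQ0]; linarith
          linarith
        have : c' s = 0 := by simp [c', max_eq_right this]
        rw [this]; simp; positivity
    have := mul_nonneg e1 (hc0 s)
    show -(4/N^3) ≤ 3/2 * (p s * c s) + _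
    linarith

lemma layer (μ : Measure ℂ) [IsLocallyFiniteMeasure μ] (f : ℂ → ℂ) (hf : Continuous f) (x : ℂ)
    (h0 : ∀ r : ℝ, 0 < r → ∫ y in ball x r, f y ∂μ = 0)
    (ψ : ℝ → ℝ) (hψ : ContDiff ℝ 1 ψ) (B : ℝ) (hB : 0 < B) (hz : ∀ s, B ≤ s → ψ s = 0) :
    ∫ y, (ψ (‖x - y‖^2) : ℂ) * f y ∂μ = 0 := by
  have hdc : Continuous (deriv ψ) := hψ.continuous_deriv le_rfl
  have hrep : ∀ s, 0 ≤ s → (ψ s : ℂ) = - ∫ u in Ioc 0 B, (if s < u then ((deriv ψ u : ℝ) : ℂ) else 0) := by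
    intro s hs
    have e1 : ∫ u in Ioc 0 B, (if s < u then ((deriv ψ u : ℝ) : ℂ) else 0) =
        ((∫ u in Ioc 0 B, (if s < u then (deriv ψ u) else 0) : ℝ) : ℂ) := by
      rw [← integral_complex_ofReal]
      congr 1; ext u; split_ifs <;> simp
    have e2 : (fun u => if s < u then deriv ψ u else 0) = (Ioi s).indicator (deriv ψ) := by
      ext u; simp [indicator]
    rw [e1, e2, setIntegral_indicator measurableSet_Ioi]
    rw [Ioc_inter_Ioi, max_eq_right hs]
    rcases le_or_gt B s with h | h
    · rw [Ioc_eq_empty (by simpa using h), hz s h]; simp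
    · rw [← intervalIntegral.integral_of_le h.le, intervalIntegral.integral_deriv_eq_sub
        (fun u _ => (hψ.differentiable (by simp)).differentiableAt) (hdc.intervalIntegrable _ _), hz B le_rfl]
      simp
  have hsupp : ∫ y, (ψ (‖x - y‖^2) : ℂ) * f y ∂μ
      = ∫ y in ball x (√B), (ψ (‖x - y‖^2) : ℂ) * f y ∂μ := by
    symm
    apply setIntegral_eq_integral_of_forall_compl_eq_zero
    intro y hy
    have : B ≤ ‖x - y‖^2 := by
      rw [mem_ball, not_lt, dist_comm, dist_eq_norm] at hy
      calc B = (√B)^2 := (Real.sq_sqrt hB.le).symm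
        _ ≤ _ := by gcongr
    simp [hz _ this]
  rw [hsupp]
  have e3 : ∀ y, (ψ (‖x - y‖^2) : ℂ) * f y = - ∫ u in Ioc 0 B, (if ‖x-y‖^2 < u then ((deriv ψ u : ℝ) : ℂ) * f y else 0) := by
    intro y
    rw [hrep _ (sq_nonneg _), neg_mul, ← integral_mul_const]
    congr 2; ext u; split_ifs <;> simp
  simp_rw [e3]
  rw [integral_neg, neg_eq_zero]
  have hfin : μ (ball x (√B)) < ∞ := measure_ball_lt_top
  have : IsFiniteMeasure (μ.restrict (ball x (√B))) := ⟨by simpa using hfin⟩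
  rw [integral_integral_swap]
  · apply integral_eq_zero_of_ae
    filter_upwards [ae_restrict_mem measurableSet_Ioc] with u hu
    have e4 : (fun y => if ‖x-y‖^2 < u then ((deriv ψ u : ℝ) : ℂ) * f y else 0) =
        (ball x (√u)).indicator (fun y => ((deriv ψ u : ℝ) : ℂ) * f y) := by
      ext y
      have : (‖x-y‖^2 < u) ↔ y ∈ ball x (√u) := by
        rw [mem_ball, dist_comm, dist_eq_norm, Real.lt_sqrt (norm_nonneg _)]
      simp [indicator, this]
    rw [e4, setIntegral_indicator measurableSet_ball]
    have : ball x (√B) ∩ ball x (√u) = ball x (√u) :=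
      inter_eq_right.2 (ball_subset_ball (Real.sqrt_le_sqrt hu.2))
    rw [this, integral_const_mul, h0 _ (Real.sqrt_pos.2 hu.1)]
    simp
  · obtain ⟨C1, hC1⟩ := (isCompact_Icc (a := (0:ℝ)) (b := B)).exists_bound_of_continuousOn hdc.continuousOn
    obtain ⟨C2, hC2⟩ := (isCompact_closedBall x (√B)).exists_bound_of_continuousOn hf.continuousOn
    have hC1' : 0 ≤ C1 := (norm_nonneg _).trans (hC1 0 ⟨le_rfl, hB.le⟩)
    refine Integrable.of_bound (C := C1 * C2) ?_ ?_
    · apply Measurable.aestronglyMeasurable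
      refine Measurable.ite ?_ ?_ measurable_const
      · exact measurableSet_lt (by fun_prop) (by fun_prop)
      · have := hdc.measurable
        have := hf.measurable
        fun_prop
    · rw [Measure.prod_restrict]
      filter_upwards [ae_restrict_mem (measurableSet_ball.prod measurableSet_Ioc)] with p hp
      have a1 := hC1 p.2 ⟨hp.2.1.le, hp.2.2⟩
      have a2 := hC2 p.1 (ball_subset_closedBall hp.1)
      have hC2' : 0 ≤ C2 := (norm_nonneg _).trans a2
      simp only [Function.uncurry]
      split_ifs
      · rw [norm_mul, Complex.norm_real]; gcongr
      · simp; positivity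

lemma Kmap_polar (Ω : ℂ → ℂ) (ω : ℝ → ℝ)
    (hl : ∀ t : ℝ, Ω (Complex.exp ((t : ℂ) * Complex.I)) = Complex.exp ((ω t : ℂ) * Complex.I))
    (ρ θ : ℝ) (hρ : 0 < ρ) (z : ℂ) (hz : z = ρ * Complex.exp (θ * I)) :
    ‖z‖ = ρ ∧ Kmap Ω z = ρ * Complex.exp (ω θ * I) := by
  have h1 : ‖z‖ = ρ := by
    rw [hz, norm_mul, Complex.norm_exp_ofReal_mul_I, Complex.norm_real, Real.norm_of_nonneg hρ.le, mul_one]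
  have hρ' : (ρ : ℂ) ≠ 0 := by exact_mod_cast hρ.ne'
  refine ⟨h1, ?_⟩
  rw [Kmap, h1, ← hl]
  congr 2
  rw [hz]; field_simp

lemma Kmap_local (Ω : ℂ → ℂ) (ω : ℝ → ℝ)
    (hl : ∀ t : ℝ, Ω (Complex.exp ((t : ℂ) * Complex.I)) = Complex.exp ((ω t : ℂ) * Complex.I))
    (z₀ : ℂ) (h₀ : z₀ ≠ 0) (z : ℂ) (hz : z ≠ 0) :
    Kmap Ω z = ‖z₀‖ * Complex.exp (((Complex.log (z / z₀)).re : ℝ) +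
      (ω (arg z₀ + (Complex.log (z/z₀)).im) : ℝ) * I) := by
  set ℓ := Complex.log (z/z₀) with hℓ
  have e1 : z = z₀ * Complex.exp ℓ := by
    rw [hℓ, Complex.exp_log (div_ne_zero hz h₀)]; field_simp
  have e2 : z = ((‖z₀‖ * Real.exp ℓ.re : ℝ) : ℂ) * Complex.exp ((arg z₀ + ℓ.im : ℝ) * I) := by
    rw [e1]
    conv_lhs => rw [← Complex.norm_mul_exp_arg_mul_I z₀, ← Complex.re_add_im ℓ]
    push_cast
    rw [add_mul, Complex.exp_add, Complex.exp_add]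
    ring
  have := (Kmap_polar Ω ω hl _ _ (by have := norm_pos_iff.2 h₀; positivity) z e2).2
  rw [this]
  push_cast
  rw [Complex.exp_add]; ring

lemma Kmap_zero (Ω : ℂ → ℂ) : Kmap Ω 0 = 0 := by simp [Kmap]

lemma Kmap_norm (Ω : ℂ → ℂ) (ω : ℝ → ℝ)
    (hl : ∀ t : ℝ, Ω (Complex.exp ((t : ℂ) * Complex.I)) = Complex.exp ((ω t : ℂ) * Complex.I))
    (z : ℂ) : ‖Kmap Ω z‖ = ‖z‖ := by
  rcases eq_or_ne z 0 with h | h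
  · simp [h, Kmap_zero]
  · have := (Kmap_polar Ω ω hl ‖z‖ (arg z) (norm_pos_iff.2 h) z (Complex.norm_mul_exp_arg_mul_I z).symm).2
    rw [this, norm_mul, Complex.norm_exp_ofReal_mul_I]; simp

lemma Kmap_smul (Ω : ℂ → ℂ) (R : ℝ) (hR : 0 < R) (z : ℂ) : Kmap Ω (z / R) = Kmap Ω z / R := by
  have hR' : (R:ℂ) ≠ 0 := by exact_mod_cast hR.ne'
  have : ‖z / (R:ℂ)‖ = ‖z‖ / R := by
    rw [norm_div, Complex.norm_real, Real.norm_of_nonneg hR.le]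
  unfold Kmap
  rw [this]
  have e : z / (R:ℂ) / ((‖z‖ / R : ℝ) : ℂ) = z / (‖z‖ : ℂ) := by
    push_cast; field_simp
  rw [e]; push_cast; ring

lemma Kmap_contDiffAt (Ω : ℂ → ℂ) (ω : ℝ → ℝ) (hω : ContDiff ℝ 1 ω)
    (hl : ∀ t : ℝ, Ω (Complex.exp ((t : ℂ) * Complex.I)) = Complex.exp ((ω t : ℂ) * Complex.I))
    (z₀ : ℂ) (h₀ : z₀ ≠ 0) : ContDiffAt ℝ 1 (Kmap Ω) z₀ := by
  have hlog : ContDiffAt ℝ 1 (fun z => Complex.log (z / z₀)) z₀ := by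
    have h1 : ContDiffAt ℝ 1 Complex.log (z₀ / z₀) := by
      have : ContDiffAt ℂ 1 Complex.log (z₀ / z₀) := Complex.contDiffAt_log (by simp [h₀])
      exact this.restrict_scalars ℝ
    exact ContDiffAt.comp (f := fun z => z / z₀) z₀ h1 (by
      simp_rw [div_eq_mul_inv]; exact contDiffAt_id.mul contDiffAt_const)
  have hre : ContDiffAt ℝ 1 (fun z => (Complex.log (z / z₀)).re) z₀ :=
    Complex.reCLM.contDiff.contDiffAt.comp z₀ hlog
  have him : ContDiffAt ℝ 1 (fun z => (Complex.log (z / z₀)).im) z₀ :=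
    Complex.imCLM.contDiff.contDiffAt.comp z₀ hlog
  have hw : ContDiffAt ℝ 1 (fun z => ω (arg z₀ + (Complex.log (z / z₀)).im)) z₀ :=
    hω.contDiffAt.comp z₀ (contDiffAt_const.add him)
  have hof : ∀ g : ℂ → ℝ, ContDiffAt ℝ 1 g z₀ → ContDiffAt ℝ 1 (fun z => (g z : ℂ)) z₀ := fun g hg =>
    Complex.ofRealCLM.contDiff.contDiffAt.comp z₀ hg
  have hexp : ContDiffAt ℝ 1 (fun z => (‖z₀‖ : ℂ) * Complex.exp (((Complex.log (z / z₀)).re : ℝ) +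
      (ω (arg z₀ + (Complex.log (z/z₀)).im) : ℝ) * I)) z₀ :=
    contDiffAt_const.mul (((hof _ hre).add ((hof _ hw).mul contDiffAt_const)).cexp)
  refine hexp.congr_of_eventuallyEq ?_
  filter_upwards [isOpen_ne.mem_nhds h₀] with z hz
  exact Kmap_local Ω ω hl z₀ h₀ z hz

lemma Kmap_continuous (Ω : ℂ → ℂ) (ω : ℝ → ℝ) (hω : ContDiff ℝ 1 ω)
    (hl : ∀ t : ℝ, Ω (Complex.exp ((t : ℂ) * Complex.I)) = Complex.exp ((ω t : ℂ) * Complex.I)) :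
    Continuous (Kmap Ω) := by
  rw [continuous_iff_continuousAt]
  intro z
  rcases eq_or_ne z 0 with h | h
  · subst h
    rw [ContinuousAt, Kmap_zero, tendsto_zero_iff_norm_tendsto_zero]
    simp_rw [Kmap_norm Ω ω hl]
    exact tendsto_norm_zero
  · exact (Kmap_contDiffAt Ω ω hω hl z h).continuousAt

lemma Kmap_fderiv (Ω : ℂ → ℂ) (ω : ℝ → ℝ) (hω : ContDiff ℝ 1 ω)
    (hl : ∀ t : ℝ, Ω (Complex.exp ((t : ℂ) * Complex.I)) = Complex.exp ((ω t : ℂ) * Complex.I))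
    (z₀ : ℂ) (h₀ : z₀ ≠ 0) (h : ℂ) : fderiv ℝ (Kmap Ω) z₀ h =
      Kmap Ω z₀ * ((h / z₀).re + (deriv ω (arg z₀) : ℝ) * (h/z₀).im * I) := by
  have hd : HasFDerivAt (Kmap Ω) (fderiv ℝ (Kmap Ω) z₀) z₀ :=
    ((Kmap_contDiffAt Ω ω hω hl z₀ h₀).differentiableAt (by simp)).hasFDerivAt
  have hline : HasDerivAt (fun t : ℝ => z₀ + t * h) h 0 := by
    simpa using ((hasDerivAt_id (0:ℝ)).ofReal_comp.mul_const h).const_add z₀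
  have hd1 : HasDerivAt (fun t : ℝ => Kmap Ω (z₀ + t * h)) (fderiv ℝ (Kmap Ω) z₀ h) 0 := by
    have hd' : HasFDerivAt (Kmap Ω) (fderiv ℝ (Kmap Ω) z₀) (z₀ + ((0:ℝ):ℂ) * h) := by simpa using hd
    exact HasFDerivAt.comp_hasDerivAt (f := fun t : ℝ => z₀ + t * h) (0:ℝ) hd' hline
  have hdiv : HasDerivAt (fun t : ℝ => (z₀ + t * h) / z₀) (h / z₀) 0 := hline.div_const z₀
  have hlog : HasDerivAt (fun t : ℝ => Complex.log ((z₀ + t * h) / z₀)) (h / z₀) 0 := by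
    have := hdiv.clog_real (by simp [h₀])
    simpa [h₀] using this
  have hre : HasDerivAt (fun t : ℝ => (Complex.log ((z₀ + t * h) / z₀)).re) (h / z₀).re 0 :=
    Complex.reCLM.hasFDerivAt.comp_hasDerivAt (0:ℝ) hlog
  have him : HasDerivAt (fun t : ℝ => (Complex.log ((z₀ + t * h) / z₀)).im) (h / z₀).im 0 :=
    Complex.imCLM.hasFDerivAt.comp_hasDerivAt (0:ℝ) hlog
  have hw : HasDerivAt (fun t : ℝ => ω (arg z₀ + (Complex.log ((z₀ + t * h) / z₀)).im))
      (deriv ω (arg z₀) * (h / z₀).im) 0 := by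
    have h1 : HasDerivAt ω (deriv ω (arg z₀)) (arg z₀ + (Complex.log ((z₀ + (0:ℝ) * h) / z₀)).im) := by
      have : arg z₀ + (Complex.log ((z₀ + (0:ℝ) * h) / z₀)).im = arg z₀ := by simp [h₀]
      rw [this]
      exact ((hω.differentiable (by simp)) _).hasDerivAt
    exact HasDerivAt.comp (0:ℝ) h1 (him.const_add (arg z₀))
  have hexp := ((hre.ofReal_comp.add (hw.ofReal_comp.mul_const I)).cexp).const_mul (‖z₀‖ : ℂ)
  have hd2 := hexp.congr_of_eventuallyEq (f₁ := fun t : ℝ => Kmap Ω (z₀ + t * h)) (by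
    have : ∀ᶠ t : ℝ in 𝓝 0, z₀ + t * h ≠ 0 := by
      apply hline.continuousAt.eventually_ne
      simpa using h₀
    filter_upwards [this] with t ht
    exact Kmap_local Ω ω hl z₀ h₀ _ ht)
  have := hd1.unique hd2
  rw [this, Kmap_local Ω ω hl z₀ h₀ z₀ h₀]
  simp [h₀]
  ring

lemma Kmap_re (Ω : ℂ → ℂ) (ω : ℝ → ℝ) (hω : ContDiff ℝ 1 ω)
    (hl : ∀ t : ℝ, Ω (Complex.exp ((t : ℂ) * Complex.I)) = Complex.exp ((ω t : ℂ) * Complex.I))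
    (h1 : ∀ t, 20/21 ≤ deriv ω t) (h2 : ∀ t, deriv ω t ≤ 21/20) (z : ℂ) (hz : z ≠ 0) :
    1/2 ≤ (Complex.exp (-(ω 0 : ℝ) * I) * Kmap Ω z / z).re ∧
    (Complex.exp (-(ω 0 : ℝ) * I) * Kmap Ω z / z).re ≤ 1 := by
  have hz0 := norm_pos_iff.2 hz
  have hz0' : (‖z‖ : ℂ) ≠ 0 := by exact_mod_cast hz0.ne'
  have := (Kmap_polar Ω ω hl ‖z‖ (arg z) hz0 z (Complex.norm_mul_exp_arg_mul_I z).symm).2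
  have e : Complex.exp (-(ω 0 : ℝ) * I) * Kmap Ω z / z = Complex.exp ((ω (arg z) - arg z - ω 0 : ℝ) * I) := by
    rw [this]
    rw [div_eq_iff hz]
    trans Complex.exp ((ω (arg z) - arg z - ω 0 : ℝ) * I) * (‖z‖ * Complex.exp (arg z * I))
    swap
    · rw [Complex.norm_mul_exp_arg_mul_I z]
    have : Complex.exp ((ω (arg z) - arg z - ω 0 : ℝ) * I) * (‖z‖ * Complex.exp (arg z * I)) =
      ‖z‖ * (Complex.exp ((ω (arg z) - arg z - ω 0 : ℝ) * I) * Complex.exp (arg z * I)) := by ring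
    rw [this, ← Complex.exp_add]
    have : Complex.exp (-(ω 0 : ℝ) * I) * (‖z‖ * Complex.exp (ω (arg z) * I)) =
      ‖z‖ * (Complex.exp (-(ω 0 : ℝ) * I) * Complex.exp (ω (arg z) * I)) := by ring
    rw [this, ← Complex.exp_add]
    congr 2; push_cast; ring
  rw [e, Complex.exp_ofReal_mul_I_re]
  refine ⟨?_, Real.cos_le_one _⟩
  have hd : ∀ t, HasDerivAt (fun t => ω t - t) (deriv ω t - 1) t := fun t =>
    ((hω.differentiable (by simp)) t).hasDerivAt.sub (hasDerivAt_id t)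
  have hb : |ω (arg z) - arg z - ω 0| ≤ 1/20 * |arg z| := by
    have := Convex.norm_image_sub_le_of_norm_hasDerivWithin_le (s := univ) (x := 0) (y := arg z)
      (C := 1/20) (fun t _ => (hd t).hasDerivWithinAt) (fun t _ => by
        rw [Real.norm_eq_abs, abs_le]; constructor <;> linarith [h1 t, h2 t]) convex_univ trivial trivial
    simpa [sub_zero] using this
  have hpi := Real.pi_pos
  have hb2 : |ω (arg z) - arg z - ω 0| ≤ Real.pi/3 := by
    have := Complex.abs_arg_le_pi z
    linarith
  rw [← Real.cos_abs, ← Real.cos_pi_div_three]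
  exact Real.cos_le_cos_of_nonneg_of_le_pi (abs_nonneg _) (by linarith) hb2

structure GoodKer (k : ℂ → ℂ) (w : ℂ) : Prop where
  cont : Continuous k
  nrm : ∀ z, ‖k z‖ = ‖z‖
  cd : ∀ z, z ≠ 0 → ContDiffAt ℝ 1 k z
  fd : ∀ z, z ≠ 0 → ∃ b : ℝ, 20/21 ≤ b ∧ b ≤ 21/20 ∧ ∀ h : ℂ,
    fderiv ℝ k z h = k z * ((h / z).re + b * (h / z).im * I)
  re : ∀ z, z ≠ 0 → 1/2 ≤ (w * k z / z).re ∧ (w * k z / z).re ≤ 1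
  scal : ∀ (R : ℝ), 0 < R → ∀ z : ℂ, k (z / R) = k z / R
  w1 : ‖w‖ = 1

structure GoodPhi (φ : ℝ → ℝ) (M E : ℝ) : Prop where
  M1 : 1 ≤ M
  E0 : 0 ≤ E
  cd : ContDiff ℝ 1 φ
  supp : ∀ s, M^2 ≤ s → φ s = 0
  nonneg : ∀ s, 0 ≤ s → 0 ≤ φ s
  le1 : ∀ s, 0 ≤ s → φ s ≤ 1
  low : ∀ s, 0 ≤ s → s ≤ 1 → 1/8 ≤ φ s
  ineq : ∀ s, 0 ≤ s → -E ≤ 3/2 * φ s + 2 * s * deriv φ s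

def GG (φ : ℝ → ℝ) (k : ℂ → ℂ) (z : ℂ) : ℂ := (φ (‖z‖^2) : ℂ) * k z

section
variable {φ : ℝ → ℝ} {M E : ℝ} {k : ℂ → ℂ} {w : ℂ}

lemma GG_supp (hφ : GoodPhi φ M E) (z : ℂ) (hz : M ≤ ‖z‖) : GG φ k z = 0 := by
  have hM := hφ.M1
  rw [GG, hφ.supp _ (by gcongr)]; simp

lemma GG_norm (hφ : GoodPhi φ M E) (hk : GoodKer k w) (z : ℂ) : ‖GG φ k z‖ ≤ ‖z‖ := by
  rw [GG, norm_mul, hk.nrm, Complex.norm_real, Real.norm_of_nonneg (hφ.nonneg _ (sq_nonneg _))]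
  have := hφ.le1 (‖z‖^2) (sq_nonneg _)
  nlinarith [norm_nonneg z]

lemma GG_cont (hφ : GoodPhi φ M E) (hk : GoodKer k w) : Continuous (GG φ k) := by
  have h1 := hφ.cd.continuous
  have h2 := hk.cont
  unfold GG
  exact (Complex.continuous_ofReal.comp (h1.comp (by fun_prop))).mul h2

lemma phi_cd (hφ : GoodPhi φ M E) : ContDiff ℝ 1 (fun z : ℂ => (φ (‖z‖^2) : ℂ)) :=
  Complex.ofRealCLM.contDiff.comp (hφ.cd.comp (contDiff_norm_sq ℝ))

lemma GG_cd (hφ : GoodPhi φ M E) (hk : GoodKer k w) (z : ℂ) (hz : z ≠ 0) :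
    ContDiffAt ℝ 1 (GG φ k) z :=
  (phi_cd hφ).contDiffAt.mul (hk.cd z hz)

lemma GG_fderiv (hφ : GoodPhi φ M E) (hk : GoodKer k w) (z : ℂ) (hz : z ≠ 0) :
    ∃ b : ℝ, 20/21 ≤ b ∧ b ≤ 21/20 ∧ ∀ h : ℂ, fderiv ℝ (GG φ k) z h =
      k z * (((φ (‖z‖^2) + 2 * ‖z‖^2 * deriv φ (‖z‖^2) : ℝ) : ℂ) * (h/z).re +
        ((b * φ (‖z‖^2) : ℝ) : ℂ) * (h/z).im * I) := by
  obtain ⟨b, hb1, hb2, hb⟩ := hk.fd z hz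
  refine ⟨b, hb1, hb2, fun h => ?_⟩
  have h1 : HasFDerivAt (fun z : ℂ => ‖z‖^2) (2 • (innerSL ℝ z)) z := by
    simpa using (hasStrictFDerivAt_norm_sq z).hasFDerivAt
  have h2 : HasDerivAt φ (deriv φ (‖z‖^2)) (‖z‖^2) :=
    ((hφ.cd.differentiable (by simp)) _).hasDerivAt
  have h3 := h2.comp_hasFDerivAt z h1
  have h4 := Complex.ofRealCLM.hasFDerivAt.comp z h3
  have h5 := h4.mul ((hk.cd z hz).differentiableAt (by simp)).hasFDerivAt
  have h6 : fderiv ℝ (GG φ k) z = _ := h5.fderiv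
  rw [h6]
  have hin : inner ℝ z h = ‖z‖^2 * (h/z).re := by
    have : h = (h/z) * z := by field_simp
    conv_lhs => rw [this]
    rw [Complex.inner, Complex.sq_norm, Complex.normSq_apply]
    simp; ring
  simp [hb h, hin]
  ring

lemma GG_fderiv_supp (hφ : GoodPhi φ M E) (z : ℂ) (hz : M < ‖z‖) : fderiv ℝ (GG φ k) z = 0 := by
  have : GG φ k =ᶠ[𝓝 z] fun _ => 0 := by
    filter_upwards [(isOpen_lt continuous_const continuous_norm).mem_nhds hz] with v hv
    exact GG_supp hφ v (le_of_lt hv)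
  rw [this.fderiv_eq]; simp

lemma GG_lip (hφ : GoodPhi φ M E) (hk : GoodKer k w) :
    ∃ L : ℝ, 1 ≤ L ∧ ∀ z v, ‖GG φ k z - GG φ k v‖ ≤ L * ‖z - v‖ := by
  have hdc : Continuous (deriv φ) := hφ.cd.continuous_deriv le_rfl
  have hc := hφ.cd.continuous
  obtain ⟨C1, hC1⟩ := (isCompact_Icc (a := (0:ℝ)) (b := M^2)).exists_bound_of_continuousOn
    (f := fun s => φ s + 2 * s * deriv φ s) (by fun_prop)
  have hM := hφ.M1
  have hC10 : 0 ≤ C1 := (norm_nonneg _).trans (hC1 0 ⟨le_rfl, by positivity⟩)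
  have key : ∀ z, z ≠ 0 → ‖fderiv ℝ (GG φ k) z‖ ≤ C1 + 2 := by
    intro z hz
    rcases lt_or_ge M ‖z‖ with h | h
    · rw [GG_fderiv_supp hφ z h]; simp; linarith
    refine ContinuousLinearMap.opNorm_le_bound _ (by linarith) fun x => ?_
    obtain ⟨b, hb1, hb2, hb⟩ := GG_fderiv hφ hk z hz
    rw [hb, norm_mul, hk.nrm]
    have a1 := hC1 (‖z‖^2) ⟨sq_nonneg _, by gcongr⟩
    have a2 : ‖b * φ (‖z‖^2)‖ ≤ 2 := by
      have i1 := hφ.nonneg (‖z‖^2) (sq_nonneg _)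
      have i2 := hφ.le1 (‖z‖^2) (sq_nonneg _)
      rw [Real.norm_of_nonneg (by positivity)]
      nlinarith
    have n1 : ‖((x/z).re : ℂ)‖ ≤ ‖x‖/‖z‖ := by
      rw [Complex.norm_real, ← norm_div]; exact Complex.abs_re_le_norm _
    have n2 : ‖((x/z).im : ℂ)‖ ≤ ‖x‖/‖z‖ := by
      rw [Complex.norm_real, ← norm_div]; exact Complex.abs_im_le_norm _
    have hz0 := norm_pos_iff.2 hz
    calc _ ≤ ‖z‖ * (C1 * (‖x‖/‖z‖) + 2 * (‖x‖/‖z‖)) := by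
          gcongr
          refine (norm_add_le _ _).trans ?_
          rw [norm_mul, norm_mul, norm_mul, Complex.norm_I, mul_one]
          rw [Complex.norm_real (φ (‖z‖^2) + 2 * ‖z‖^2 * deriv φ (‖z‖^2)), Complex.norm_real (b * φ (‖z‖^2))]
          gcongr
      _ = _ := by field_simp
  refine ⟨C1 + 2, by linarith, fun z v => ?_⟩
  by_cases h0 : (0:ℂ) ∈ segment ℝ v z
  · have := dist_add_dist_of_mem_segment h0
    simp only [dist_eq_norm, sub_zero, zero_sub, norm_neg] at this
    rw [norm_sub_rev v z] at this
    calc _ ≤ ‖GG φ k z‖ + ‖GG φ k v‖ := norm_sub_le _ _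
      _ ≤ ‖z‖ + ‖v‖ := add_le_add (GG_norm hφ hk z) (GG_norm hφ hk v)
      _ = 1 * ‖z - v‖ := by linarith
      _ ≤ _ := by gcongr; linarith
  · have hne : ∀ x ∈ segment ℝ v z, x ≠ 0 := fun x hx h => h0 (h ▸ hx)
    exact (convex_segment v z).norm_image_sub_le_of_norm_fderiv_le (𝕜 := ℝ)
      (fun x hx => (GG_cd hφ hk x (hne x hx)).differentiableAt (by simp))
      (fun x hx => key x (hne x hx)) (left_mem_segment ℝ v z) (right_mem_segment ℝ v z)

lemma GG_unif (hφ : GoodPhi φ M E) (hk : GoodKer k w) (η ε : ℝ) (hη : 0 < η) (hε : 0 < ε) :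
    ∃ τ : ℝ, 0 < τ ∧ τ ≤ 1 ∧ ∀ z h : ℂ, η ≤ ‖z‖ → ‖z‖ ≤ M + 1 → ‖h‖ ≤ τ →
      ‖GG φ k (z + h) - GG φ k z - fderiv ℝ (GG φ k) z h‖ ≤ ε * ‖h‖ := by
  set A : Set ℂ := closedBall 0 (M + 2) ∩ {z | η/2 ≤ ‖z‖} with hA
  have hAc : IsCompact A := (isCompact_closedBall _ _).inter_right
    (isClosed_le continuous_const continuous_norm)
  have hcont : ContinuousOn (fderiv ℝ (GG φ k)) A := by
    intro z hz
    have hz0 : z ≠ 0 := norm_pos_iff.1 (lt_of_lt_of_le (by linarith) hz.2)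
    exact ((GG_cd hφ hk z hz0).continuousAt_fderiv (by simp)).continuousWithinAt
  have huc := hAc.uniformContinuousOn_of_continuous hcont
  rw [Metric.uniformContinuousOn_iff] at huc
  obtain ⟨d, hd, hd2⟩ := huc ε hε
  refine ⟨min (d/2) (min (η/2) 1), by positivity, (min_le_right _ _).trans (min_le_right _ _), ?_⟩
  intro z h hz1 hz2 hh
  have t1 : ‖h‖ ≤ d/2 := hh.trans (min_le_left _ _)
  have t2 : ‖h‖ ≤ η/2 := hh.trans ((min_le_right _ _).trans (min_le_left _ _))
  have t3 : ‖h‖ ≤ 1 := hh.trans ((min_le_right _ _).trans (min_le_right _ _))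
  have hball : ∀ x ∈ closedBall z ‖h‖, x ∈ A := by
    intro x hx
    rw [mem_closedBall, dist_eq_norm] at hx
    constructor
    · rw [mem_closedBall, dist_zero_right]
      have := norm_le_norm_add_norm_sub' x z
      linarith
    · have := norm_le_norm_add_norm_sub' z x
      rw [norm_sub_rev] at this
      show η/2 ≤ ‖x‖
      linarith
  have hzb : z ∈ closedBall z ‖h‖ := mem_closedBall_self (norm_nonneg _)
  have := (convex_closedBall z ‖h‖).norm_image_sub_le_of_norm_fderiv_le' (𝕜 := ℝ) (f := GG φ k)
    (φ := fderiv ℝ (GG φ k) z) (C := ε) (x := z) (y := z + h)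
    (fun x hx => (GG_cd hφ hk x (norm_pos_iff.1 (lt_of_lt_of_le (by linarith) (hball x hx).2))).differentiableAt (by simp))
    (fun x hx => by
      have := hd2 x (hball x hx) z (hball z hzb) (lt_of_le_of_lt hx (by linarith))
      rw [dist_eq_norm] at this; exact this.le)
    hzb (by simp)
  simpa using this

lemma GG_trace (hφ : GoodPhi φ M E) (hk : GoodKer k w) (z : ℂ) (hz : z ≠ 0) :
    (ball (0:ℂ) 1).indicator (fun _ => (1/50:ℝ)) z - (ball (0:ℂ) (M+1)).indicator (fun _ => E) z ≤
    (w * fderiv ℝ (GG φ k) z 1).re + (w * fderiv ℝ (GG φ k) z I).im := by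
  have hM := hφ.M1
  have hE := hφ.E0
  rcases lt_or_ge M ‖z‖ with h | h
  · rw [GG_fderiv_supp hφ z h]
    have : z ∉ ball (0:ℂ) 1 := by simp; linarith
    rw [indicator_of_notMem this]
    simp only [zero_sub, zero_apply, mul_zero, zero_re, zero_im, add_zero]
    have := indicator_nonneg (s := ball (0:ℂ) (M+1)) (f := fun _ => E) (fun _ _ => hE) z
    linarith
  · have : z ∈ ball (0:ℂ) (M+1) := by simp; linarith
    rw [indicator_of_mem this]
    obtain ⟨b, hb1, hb2, hb⟩ := GG_fderiv hφ hk z hz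
    set s := ‖z‖^2 with hs
    have hs0 : 0 ≤ s := sq_nonneg _
    obtain ⟨q1, q2⟩ := hk.re z hz
    set q := w * k z / z with hq
    have hqz : w * k z = q * z := by rw [hq]; field_simp
    have htr : (w * fderiv ℝ (GG φ k) z 1).re + (w * fderiv ℝ (GG φ k) z I).im =
        (φ s + 2 * s * deriv φ s + b * φ s) * q.re := by
      rw [hb, hb, ← mul_assoc, ← mul_assoc, hqz]
      have hn : z.re ^ 2 + z.im ^ 2 ≠ 0 := by
        have := Complex.normSq_pos.2 hz
        rw [Complex.normSq_apply, ← pow_two, ← pow_two] at this; exact this.ne'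
      have r1 : (1/z).re = z.re / (z.re^2+z.im^2) := by
        rw [Complex.div_re, Complex.normSq_apply]; simp; ring
      have r2 : (1/z).im = -z.im / (z.re^2+z.im^2) := by
        rw [Complex.div_im, Complex.normSq_apply]; simp; ring
      have r3 : (I/z).re = z.im / (z.re^2+z.im^2) := by
        rw [Complex.div_re, Complex.normSq_apply]; simp; ring
      have r4 : (I/z).im = z.re / (z.re^2+z.im^2) := by
        rw [Complex.div_im, Complex.normSq_apply]; simp; ring
      have gen : ∀ (P : ℂ) (α β X Y X' Y' : ℝ), (P*((α:ℂ)*X+(β:ℂ)*Y*I)).re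
          + (P*((α:ℂ)*X'+(β:ℂ)*Y'*I)).im
          = P.re*α*X - P.im*β*Y + P.im*α*X' + P.re*β*Y' := by
        intros; simp; ring
      rw [gen, r1, r2, r3, r4]
      simp only [Complex.mul_re, Complex.mul_im]
      field_simp
      ring
    rw [htr]
    have i1 := hφ.ineq s hs0
    have i2 := hφ.nonneg s hs0
    have j1 : -E ≤ (3/2 * φ s + 2 * s * deriv φ s) * q.re := by nlinarith
    have j2 : 9/40 * φ s ≤ ((b - 1/2) * φ s) * q.re := by
      have : 9/20 * φ s ≤ (b - 1/2) * φ s := by nlinarith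
      nlinarith
    have j3 : (ball (0:ℂ) 1).indicator (fun _ => (1/50:ℝ)) z ≤ 9/40 * φ s := by
      by_cases hz1 : z ∈ ball (0:ℂ) 1
      · rw [indicator_of_mem hz1]
        have : ‖z‖ < 1 := by simpa using hz1
        have := hφ.low s hs0 (by rw [hs]; nlinarith [norm_nonneg z])
        linarith
      · rw [indicator_of_notMem hz1]; linarith
    linarith
end

lemma real_ball {μ : Measure ℂ} {C₀ : ℝ} (hC₀ : 0 < C₀) (hreg : Ahlfors1 μ C₀) {a : ℂ} (ha : a ∈ spt μ)
    (r : ℝ) (hr : 0 < r) : C₀⁻¹ * r ≤ μ.real (ball a r) ∧ μ.real (ball a r) ≤ C₀ * r := by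
  obtain ⟨h1, h2⟩ := hreg a ha r hr
  have hfin : μ (ball a r) ≠ ∞ := ne_top_of_le_ne_top ENNReal.ofReal_ne_top h2
  constructor
  · exact (ENNReal.ofReal_le_iff_le_toReal hfin).1 h1
  · exact ENNReal.toReal_le_of_le_ofReal (by positivity) h2

lemma measure_pt {μ : Measure ℂ} {C₀ : ℝ} (hreg : Ahlfors1 μ C₀) {a : ℂ} (ha : a ∈ spt μ) :
    μ {a} = 0 := by
  have h1 : ∀ r : ℝ, 0 < r → μ {a} ≤ ENNReal.ofReal (C₀ * r) := fun r hr =>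
    (measure_mono (singleton_subset_iff.2 (mem_ball_self hr))).trans (hreg a ha r hr).2
  have h2 : Tendsto (fun r : ℝ => ENNReal.ofReal (C₀ * r)) (𝓝[>] 0) (𝓝 0) := by
    have : Tendsto (fun r : ℝ => ENNReal.ofReal (C₀ * r)) (𝓝 0) (𝓝 (ENNReal.ofReal (C₀ * 0))) :=
      (ENNReal.continuous_ofReal.comp (continuous_const.mul continuous_id)).tendsto 0
    simp only [mul_zero, ENNReal.ofReal_zero] at this
    exact this.mono_left nhdsWithin_le_nhds
  refine le_antisymm (ge_of_tendsto h2 ?_) zero_le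
  filter_upwards [self_mem_nhdsWithin] with r hr using h1 r hr

section
variable {φ : ℝ → ℝ} {M E : ℝ} {k : ℂ → ℂ} {w : ℂ} {μ : Measure ℂ} [IsLocallyFiniteMeasure μ]

lemma GG_int (hφ : GoodPhi φ M E) (hk : GoodKer k w) (x : ℂ) (R : ℝ) (hR : 0 < R) :
    Integrable (fun y => GG φ k ((x - y) / R)) μ := by
  have hc : Continuous (fun y => GG φ k ((x - y) / R)) := (GG_cont hφ hk).comp (by fun_prop)
  refine hc.integrable_of_hasCompactSupport ?_
  refine HasCompactSupport.intro (isCompact_closedBall x (M * R)) fun y hy => ?_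
  apply GG_supp hφ
  rw [mem_closedBall, not_le, dist_comm, dist_eq_norm] at hy
  rw [norm_div, Complex.norm_real, Real.norm_of_nonneg hR.le, le_div_iff₀ hR]
  exact hy.le

lemma dGG_int (hφ : GoodPhi φ M E) (hk : GoodKer k w) (x : ℂ) (R : ℝ) (hR : 0 < R) (h : ℂ) :
    Integrable (fun y => fderiv ℝ (GG φ k) ((x - y) / R) h) μ := by
  obtain ⟨L, hL, hlip⟩ := GG_lip hφ hk
  have hmeas : Measurable (fun y : ℂ => fderiv ℝ (GG φ k) ((x - y) / R) h) :=
    (measurable_fderiv_apply_const ℝ (GG φ k) h).comp (by fun_prop)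
  have hs : Function.support (fun y => fderiv ℝ (GG φ k) ((x - y) / R) h) ⊆ closedBall x (M * R) := by
    intro y hy
    by_contra hn
    rw [mem_closedBall, not_le, dist_comm, dist_eq_norm] at hn
    apply hy
    show fderiv ℝ (GG φ k) ((x - y) / R) h = 0
    rw [GG_fderiv_supp hφ]
    · simp
    · rw [norm_div, Complex.norm_real, Real.norm_of_nonneg hR.le, lt_div_iff₀ hR]; exact hn
  rw [← integrableOn_iff_integrable_of_support_subset hs]
  refine IntegrableOn.of_bound measure_closedBall_lt_top hmeas.aestronglyMeasurable (L * ‖h‖) ?_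
  refine Eventually.of_forall fun y => ?_
  refine (ContinuousLinearMap.le_opNorm _ _).trans ?_
  gcongr
  refine norm_fderiv_le_of_lip' ℝ (by linarith) ?_
  exact Eventually.of_forall fun v => hlip v _

lemma GG_vanish (hφ : GoodPhi φ M E) (hk : GoodKer k w)
    (hs : ∀ x ∈ spt μ, ∀ r : ℝ, 0 < r → (∫ y in ball x r, k (x - y) ∂μ) = 0)
    (x : ℂ) (hx : x ∈ spt μ) (R : ℝ) (hR : 0 < R) : ∫ y, GG φ k ((x - y) / R) ∂μ = 0 := by
  have hM := hφ.M1
  have := layer μ (fun y => k (x - y)) (hk.cont.comp (by fun_prop)) x (hs x hx) (fun s => φ (s / R^2))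
    (hφ.cd.comp (contDiff_id.div_const _)) (M^2 * R^2) (by positivity) (fun s hs => by
      apply hφ.supp; rw [le_div_iff₀ (by positivity)]; exact hs)
  have e : ∀ y, GG φ k ((x - y) / R) = (R:ℂ)⁻¹ * ((φ (‖x - y‖^2 / R^2) : ℂ) * k (x - y)) := by
    intro y
    rw [GG, hk.scal R hR, norm_div, Complex.norm_real, Real.norm_of_nonneg hR.le, div_pow]
    ring
  simp_rw [e]
  rw [integral_const_mul, this, mul_zero]

lemma J_tendsto (hφ : GoodPhi φ M E) (hk : GoodKer k w) {C₀ : ℝ} (hC₀ : 0 < C₀) (hreg : Ahlfors1 μ C₀)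
    (hs : ∀ x ∈ spt μ, ∀ r : ℝ, 0 < r → (∫ y in ball x r, k (x - y) ∂μ) = 0)
    (a h : ℂ) (ha : a ∈ spt μ) (hah : a + h ∈ spt μ) :
    Tendsto (fun R : ℝ => (R:ℂ)⁻¹ * ∫ y, fderiv ℝ (GG φ k) ((a - y) / R) h ∂μ) atTop (𝓝 0) := by
  have hM := hφ.M1
  obtain ⟨L, hL, hlip⟩ := GG_lip hφ hk
  rw [Metric.tendsto_atTop]
  intro ε hε
  set H := ‖h‖ + 1 with hH
  have hh0 := norm_nonneg h
  have hH0 : 0 < H := by linarith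
  set η := ε / (8 * L * C₀ * H) with hη
  set ε' := ε / (4 * C₀ * H * (M+1)) with hε'
  have hη0 : 0 < η := by positivity
  have hε0 : 0 < ε' := by positivity
  obtain ⟨τ, hτ, hτ1, hu⟩ := GG_unif hφ hk η ε' hη0 hε0
  refine ⟨H / τ, fun R hR => ?_⟩
  have hR0 : 0 < R := lt_of_lt_of_le (by positivity) hR
  have hRc : (R:ℂ) ≠ 0 := by exact_mod_cast hR0.ne'
  have hnR : ‖h / (R:ℂ)‖ = ‖h‖ / R := by rw [norm_div, Complex.norm_real, Real.norm_of_nonneg hR0.le]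
  have hhR : ‖h / (R:ℂ)‖ ≤ τ := by
    rw [hnR, div_le_iff₀ hR0]
    rw [ge_iff_le, div_le_iff₀ hτ] at hR
    linarith
  have hny : ∀ y : ℂ, ‖(a - y) / (R:ℂ)‖ = dist y a / R := fun y => by
    rw [norm_div, Complex.norm_real, Real.norm_of_nonneg hR0.le, dist_comm, dist_eq_norm]
  set F : ℂ → ℂ := fun y => GG φ k ((a - y) / R + h / R) - GG φ k ((a - y) / R)
    - fderiv ℝ (GG φ k) ((a - y) / R) (h / R) with hF
  have hFint : ∫ y, F y ∂μ = - ((R:ℂ)⁻¹ * ∫ y, fderiv ℝ (GG φ k) ((a - y) / R) h ∂μ) := by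
    have e1 : ∀ y, GG φ k ((a - y) / R + h / R) = GG φ k ((a + h - y) / R) := fun y => by
      congr 1; ring
    have e2 : ∀ y, fderiv ℝ (GG φ k) ((a - y) / R) (h / R) =
        (R:ℂ)⁻¹ * fderiv ℝ (GG φ k) ((a - y) / R) h := fun y => by
      have : h / (R:ℂ) = (R⁻¹ : ℝ) • h := by rw [Complex.real_smul]; push_cast; ring
      rw [this, map_smul, Complex.real_smul]; push_cast; ring
    simp only [hF, e1, e2]
    rw [integral_sub, integral_sub, GG_vanish hφ hk hs _ hah R hR0, GG_vanish hφ hk hs _ ha R hR0,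
      integral_const_mul]
    · simp
    · exact GG_int hφ hk _ _ hR0
    · exact GG_int hφ hk _ _ hR0
    · exact (GG_int hφ hk _ _ hR0).sub (GG_int hφ hk _ _ hR0)
    · exact (dGG_int hφ hk _ _ hR0 h).const_mul _
  set B1 := ball a (η * R) with hB1
  set B2 := ball a ((M + 1) * R) with hB2
  have hpt : ∀ y, ‖F y‖ ≤ B1.indicator (fun _ => 2 * L * (‖h‖ / R)) y
      + B2.indicator (fun _ => ε' * (‖h‖ / R)) y := by
    intro y
    have p1 : 0 ≤ B1.indicator (fun _ => 2 * L * (‖h‖ / R)) y :=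
      indicator_nonneg (fun _ _ => by positivity) _
    have p2 : 0 ≤ B2.indicator (fun _ => ε' * (‖h‖ / R)) y :=
      indicator_nonneg (fun _ _ => by positivity) _
    by_cases hy2 : y ∈ B2
    · by_cases hy1 : y ∈ B1
      · rw [indicator_of_mem hy1]
        have q1 : ‖GG φ k ((a - y) / R + h / R) - GG φ k ((a - y) / R)‖ ≤ L * (‖h‖ / R) := by
          have := hlip ((a - y) / R + h / R) ((a - y) / R)
          rwa [add_sub_cancel_left, hnR] at this
        have q2 : ‖fderiv ℝ (GG φ k) ((a - y) / R) (h / R)‖ ≤ L * (‖h‖ / R) := by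
          refine (ContinuousLinearMap.le_opNorm _ _).trans ?_
          rw [hnR]
          gcongr
          exact norm_fderiv_le_of_lip' ℝ (by linarith) (Eventually.of_forall fun v => hlip v _)
        have q3 : ‖F y‖ ≤ _ := norm_sub_le _ _
        linarith
      · rw [indicator_of_mem hy2]
        have := hu ((a - y) / R) (h / R) ?_ ?_ hhR
        · rw [hnR] at this
          have q : ‖F y‖ ≤ ε' * (‖h‖ / R) := this
          linarith
        · rw [hny, le_div_iff₀ hR0]; simpa [hB1] using hy1
        · rw [hny, div_le_iff₀ hR0]; exact (mem_ball.1 hy2).le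
    · have hbig : M + 1 ≤ ‖(a - y) / (R:ℂ)‖ := by
        rw [hny, le_div_iff₀ hR0]; simpa [hB2] using hy2
      have q1 : GG φ k ((a - y) / R) = 0 := GG_supp hφ _ (by linarith)
      have q2 : GG φ k ((a - y) / R + h / R) = 0 := GG_supp hφ _ (by
        have := norm_sub_le_norm_add ((a - y) / (R:ℂ)) (h / R)
        linarith)
      have q3 : fderiv ℝ (GG φ k) ((a - y) / R) = 0 := GG_fderiv_supp hφ _ (by linarith)
      have : F y = 0 := by simp only [hF, q1, q2, q3]; simp
      rw [this, norm_zero]; linarith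
  have i1 : Integrable (B1.indicator (fun _ => 2 * L * (‖h‖ / R))) μ :=
    (integrable_indicator_iff measurableSet_ball).2 (integrableOn_const measure_ball_lt_top.ne)
  have i2 : Integrable (B2.indicator (fun _ => ε' * (‖h‖ / R))) μ :=
    (integrable_indicator_iff measurableSet_ball).2 (integrableOn_const measure_ball_lt_top.ne)
  have hle := norm_integral_le_of_norm_le (i1.add i2) (Eventually.of_forall hpt)
  simp only [Pi.add_apply] at hle
  rw [integral_add i1 i2, integral_indicator_const _ measurableSet_ball,
    integral_indicator_const _ measurableSet_ball, hFint, norm_neg, smul_eq_mul, smul_eq_mul] at hle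
  have m1 := (real_ball hC₀ hreg ha (η * R) (by positivity)).2
  have m2 := (real_ball hC₀ hreg ha ((M+1) * R) (by positivity)).2
  rw [dist_zero_right]
  refine lt_of_le_of_lt hle ?_
  calc μ.real B1 * (2 * L * (‖h‖ / R)) + μ.real B2 * (ε' * (‖h‖ / R))
      ≤ (C₀ * (η * R)) * (2 * L * (H / R)) + (C₀ * ((M+1) * R)) * (ε' * (H / R)) := by
        have : ‖h‖ ≤ H := by linarith
        gcongr
    _ = ε / 2 := by rw [hη, hε']; field_simp; ring
    _ < ε := by linarith

lemma tr_low (hφ : GoodPhi φ M E) (hk : GoodKer k w) {C₀ : ℝ} (hC₀ : 0 < C₀) (hreg : Ahlfors1 μ C₀)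
    (a : ℂ) (ha : a ∈ spt μ) (R : ℝ) (hR : 0 < R) :
    1/50 * C₀⁻¹ - E * (C₀ * (M+1)) ≤
     (w * ((R:ℂ)⁻¹ * ∫ y, fderiv ℝ (GG φ k) ((a - y) / R) 1 ∂μ)).re +
     (w * ((R:ℂ)⁻¹ * ∫ y, fderiv ℝ (GG φ k) ((a - y) / R) I ∂μ)).im := by
  have hM := hφ.M1
  have hE := hφ.E0
  have j1 : Integrable (fun y => w * fderiv ℝ (GG φ k) ((a - y) / R) 1) μ := (dGG_int hφ hk a R hR 1).const_mul w
  have j2 : Integrable (fun y => w * fderiv ℝ (GG φ k) ((a - y) / R) I) μ := (dGG_int hφ hk a R hR I).const_mul w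
  have e1 : (w * ((R:ℂ)⁻¹ * ∫ y, fderiv ℝ (GG φ k) ((a - y) / R) 1 ∂μ)).re
      = R⁻¹ * ∫ y, (w * fderiv ℝ (GG φ k) ((a - y) / R) 1).re ∂μ := by
    have : ∫ y, (w * fderiv ℝ (GG φ k) ((a - y) / R) 1).re ∂μ = (∫ y, w * fderiv ℝ (GG φ k) ((a - y) / R) 1 ∂μ).re :=
      integral_re j1
    rw [this, integral_const_mul, ← Complex.re_ofReal_mul]
    congr 1; push_cast; ring
  have e2 : (w * ((R:ℂ)⁻¹ * ∫ y, fderiv ℝ (GG φ k) ((a - y) / R) I ∂μ)).im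
      = R⁻¹ * ∫ y, (w * fderiv ℝ (GG φ k) ((a - y) / R) I).im ∂μ := by
    have : ∫ y, (w * fderiv ℝ (GG φ k) ((a - y) / R) I).im ∂μ = (∫ y, w * fderiv ℝ (GG φ k) ((a - y) / R) I ∂μ).im :=
      integral_im j2
    rw [this, integral_const_mul, ← Complex.im_ofReal_mul]
    congr 1; push_cast; ring
  have j1' : Integrable (fun y => (w * fderiv ℝ (GG φ k) ((a - y) / R) 1).re) μ := j1.re
  have j2' : Integrable (fun y => (w * fderiv ℝ (GG φ k) ((a - y) / R) I).im) μ := j2.im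
  rw [e1, e2, ← mul_add, ← integral_add j1' j2']
  set B1 := ball a R with hB1
  set B2 := ball a ((M + 1) * R) with hB2
  have i1 : Integrable (B1.indicator (fun _ => (1/50:ℝ))) μ :=
    (integrable_indicator_iff measurableSet_ball).2 (integrableOn_const measure_ball_lt_top.ne)
  have i2 : Integrable (B2.indicator (fun _ => E)) μ :=
    (integrable_indicator_iff measurableSet_ball).2 (integrableOn_const measure_ball_lt_top.ne)
  have hne : ∀ᵐ y ∂μ, y ≠ a := by
    rw [ae_iff]; simpa using measure_pt hreg ha
  have hle := integral_mono_ae (i1.sub i2) (j1'.add j2') (by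
    filter_upwards [hne] with y hy
    have hRc : (R:ℂ) ≠ 0 := by exact_mod_cast hR.ne'
    have := GG_trace hφ hk ((a - y) / R) (div_ne_zero (sub_ne_zero.2 hy.symm) hRc)
    have hny : ‖(a - y) / (R:ℂ)‖ = dist y a / R := by
      rw [norm_div, Complex.norm_real, Real.norm_of_nonneg hR.le, dist_comm, dist_eq_norm]
    have s1 : ((a - y) / (R:ℂ) ∈ ball (0:ℂ) 1) ↔ y ∈ B1 := by
      rw [mem_ball, dist_zero_right, hny, div_lt_iff₀ hR, one_mul, hB1, mem_ball]
    have s2 : ((a - y) / (R:ℂ) ∈ ball (0:ℂ) (M+1)) ↔ y ∈ B2 := by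
      rw [mem_ball, dist_zero_right, hny, div_lt_iff₀ hR, hB2, mem_ball]
    have d1 : (ball (0:ℂ) 1).indicator (fun _ => (1/50:ℝ)) ((a - y) / R)
        = B1.indicator (fun _ => (1/50:ℝ)) y := by
      by_cases hb : y ∈ B1
      · rw [indicator_of_mem hb, indicator_of_mem (s1.2 hb)]
      · rw [indicator_of_notMem hb, indicator_of_notMem (fun h => hb (s1.1 h))]
    have d2 : (ball (0:ℂ) (M+1)).indicator (fun _ => E) ((a - y) / R)
        = B2.indicator (fun _ => E) y := by
      by_cases hb : y ∈ B2
      · rw [indicator_of_mem hb, indicator_of_mem (s2.2 hb)]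
      · rw [indicator_of_notMem hb, indicator_of_notMem (fun h => hb (s2.1 h))]
    rw [d1, d2] at this
    exact this)
  simp only [Pi.add_apply, Pi.sub_apply] at hle
  rw [integral_sub i1 i2, integral_indicator_const _ measurableSet_ball,
    integral_indicator_const _ measurableSet_ball, smul_eq_mul, smul_eq_mul] at hle
  have m1 := (real_ball hC₀ hreg ha R hR).1
  have m2 := (real_ball hC₀ hreg ha ((M+1) * R) (by positivity)).2
  calc 1/50 * C₀⁻¹ - E * (C₀ * (M+1)) = R⁻¹ * (C₀⁻¹ * R * (1/50) - (C₀ * ((M+1) * R)) * E) := by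
        field_simp
    _ ≤ R⁻¹ * (μ.real B1 * (1/50) - μ.real B2 * E) := by gcongr
    _ ≤ _ := by gcongr

theorem main_ker (hk : GoodKer k w) {C₀ : ℝ} (hC₀ : 0 < C₀) (hreg : Ahlfors1 μ C₀)
    (hs : ∀ x ∈ spt μ, ∀ r : ℝ, 0 < r → (∫ y in ball x r, k (x - y) ∂μ) = 0) :
    ∃ L : Set ℂ, IsLine L ∧ spt μ ⊆ L := by
  by_cases hne : ∃ a ∈ spt μ, ∃ x ∈ spt μ, x ≠ a
  swap
  · push Not at hne
    by_cases h : ∃ a, a ∈ spt μ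
    · obtain ⟨a, ha⟩ := h
      refine ⟨_, ⟨a, 1, one_ne_zero, rfl⟩, fun x hx => ⟨0, ?_⟩⟩
      simpa using hne a ha x hx
    · push Not at h
      exact ⟨_, ⟨0, 1, one_ne_zero, rfl⟩, fun x hx => absurd hx (h x)⟩
  obtain ⟨a, ha, x₁, hx₁, hxa⟩ := hne
  refine ⟨_, ⟨a, x₁ - a, sub_ne_zero.2 hxa, rfl⟩, fun x hx => ?_⟩
  obtain ⟨p, hp⟩ : ∃ p, p = x₁ - a := ⟨_, rfl⟩
  obtain ⟨h, hh⟩ : ∃ h, h = x - a := ⟨_, rfl⟩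
  have hp0 : p ≠ 0 := hp ▸ sub_ne_zero.2 hxa
  rw [mem_setOf_eq, ← hp]
  by_cases hD : p.re * h.im - p.im * h.re = 0
  · have hn : p.re ^ 2 + p.im ^ 2 ≠ 0 := by
      have := Complex.normSq_pos.2 hp0
      rw [Complex.normSq_apply, ← pow_two, ← pow_two] at this; exact this.ne'
    obtain ⟨c, hc⟩ : ∃ c : ℝ, c = (h.re * p.re + h.im * p.im) / (p.re^2 + p.im^2) := ⟨_, rfl⟩
    refine ⟨c, ?_⟩
    have hx' : x = a + h := by rw [hh]; ring
    rw [hx']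
    congr 1
    apply Complex.ext
    · simp; rw [hc]; field_simp; linear_combination (-p.im) * hD
    · simp; rw [hc]; field_simp; linear_combination (p.re) * hD
  exfalso
  obtain ⟨M, E, φ, f1, f2, f3, f4, f5, f6, f7, f8, f9⟩ := phi_exists (1/(200 * C₀^2)) (by positivity)
  have hφ : GoodPhi φ M E := ⟨f1, f2, f4, f5, f6, f7, f8, f9⟩
  have t1 := J_tendsto hφ hk hC₀ hreg hs a p ha (by rw [hp]; simpa using hx₁)
  have t2 := J_tendsto hφ hk hC₀ hreg hs a h ha (by rw [hh]; simpa using hx)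
  have tv : ∀ v : ℂ, Tendsto (fun R : ℝ => (R:ℂ)⁻¹ * ∫ y, fderiv ℝ (GG φ k) ((a - y) / R) v ∂μ) atTop (𝓝 0) := by
    intro v
    set D := p.re * h.im - p.im * h.re with hDd
    set c1 := (v.re * h.im - v.im * h.re) / D with hc1
    set c2 := (p.re * v.im - p.im * v.re) / D with hc2
    have hv : v = c1 • p + c2 • h := by
      apply Complex.ext
      · simp [hc1, hc2]; field_simp; rw [hDd]; ring
      · simp [hc1, hc2]; field_simp; rw [hDd]; ring
    have := (t1.const_mul (c1:ℂ)).add (t2.const_mul (c2:ℂ))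
    simp only [mul_zero, add_zero] at this
    refine this.congr' ?_
    filter_upwards [eventually_gt_atTop 0] with R hR
    have ev : ∀ y, fderiv ℝ (GG φ k) ((a - y) / R) v =
        (c1:ℂ) * fderiv ℝ (GG φ k) ((a - y) / R) p + (c2:ℂ) * fderiv ℝ (GG φ k) ((a - y) / R) h := by
      intro y
      have h3 := congrArg (fderiv ℝ (GG φ k) ((a - y) / R)) hv
      rw [map_add, map_smul, map_smul, Complex.real_smul, Complex.real_smul] at h3
      exact h3
    simp_rw [ev]
    rw [integral_add ((dGG_int hφ hk a R hR p).const_mul _) ((dGG_int hφ hk a R hR h).const_mul _),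
      integral_const_mul, integral_const_mul]
    ring
  have l1 : Tendsto (fun R : ℝ => (w * ((R:ℂ)⁻¹ * ∫ y, fderiv ℝ (GG φ k) ((a - y) / R) 1 ∂μ)).re +
     (w * ((R:ℂ)⁻¹ * ∫ y, fderiv ℝ (GG φ k) ((a - y) / R) I ∂μ)).im) atTop (𝓝 0) := by
    have a1 := (Complex.continuous_re.tendsto _).comp ((tv 1).const_mul w)
    have a2 := (Complex.continuous_im.tendsto _).comp ((tv I).const_mul w)
    simpa using a1.add a2
  have hle := ge_of_tendsto l1 (by
    filter_upwards [eventually_gt_atTop 0] with R hR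
    exact tr_low hφ hk hC₀ hreg a ha R hR)
  have g1 : E * (C₀ * (M+1)) ≤ 1/100 * C₀⁻¹ := by
    calc E * (C₀ * (M+1)) ≤ E * (C₀ * (2 * M)) := by gcongr; linarith
      _ = 2 * C₀ * (E * M) := by ring
      _ ≤ 2 * C₀ * (1/(200 * C₀^2)) := by gcongr
      _ = _ := by field_simp; norm_num
  have : 0 < C₀⁻¹ := by positivity
  linarith
end

lemma dS_exp (a b : ℝ) (h : |a - b| ≤ Real.pi) :
    dS (Complex.exp (a * I)) (Complex.exp (b * I)) = |a - b| := by
  unfold dS rinner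
  rw [Complex.exp_ofReal_mul_I_re, Complex.exp_ofReal_mul_I_re, Complex.exp_ofReal_mul_I_im,
    Complex.exp_ofReal_mul_I_im, ← Real.cos_sub, ← Real.cos_abs, Real.arccos_cos (abs_nonneg _) h]

lemma deriv_bounds (δ : ℝ) (hδ0 : 0 ≤ δ) (hδ1 : δ ≤ 1 / 20) (Ω : ℂ → ℂ) (hb : BiLipOnCircle Ω δ)
    (ω : ℝ → ℝ) (hω : ContDiff ℝ 1 ω)
    (hl : ∀ t : ℝ, Ω (Complex.exp ((t : ℂ) * Complex.I)) = Complex.exp ((ω t : ℂ) * Complex.I)) (s : ℝ) :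
    20/21 ≤ |deriv ω s| ∧ |deriv ω s| ≤ 21/20 := by
  have hd : HasDerivAt ω (deriv ω s) s := ((hω.differentiable (by simp)) s).hasDerivAt
  have ht := (hasDerivAt_iff_tendsto_slope.1 hd).abs
  have hpi := Real.pi_pos
  have ev : ∀ᶠ t in 𝓝[≠] s, 20/21 ≤ |slope ω s t| ∧ |slope ω s t| ≤ 21/20 := by
    have e1 : ∀ᶠ t in 𝓝 s, |ω t - ω s| < Real.pi := by
      have : Tendsto (fun t => |ω t - ω s|) (𝓝 s) (𝓝 |ω s - ω s|) :=
        ((hω.continuous.tendsto s).sub_const _).abs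
      simp only [sub_self, abs_zero] at this
      exact this.eventually_lt_const hpi
    have e2 : ∀ᶠ t in 𝓝 s, |t - s| < Real.pi := by
      have : Tendsto (fun t => |t - s|) (𝓝 s) (𝓝 |s - s|) := (tendsto_id.sub_const _).abs
      simp only [sub_self, abs_zero] at this
      exact this.eventually_lt_const hpi
    filter_upwards [self_mem_nhdsWithin, nhdsWithin_le_nhds e1, nhdsWithin_le_nhds e2] with t h1 h2 h3
    have hts : 0 < |t - s| := abs_pos.2 (sub_ne_zero.2 h1)
    obtain ⟨g1, g2⟩ := hb (Complex.exp (t * I)) (Complex.exp (s * I))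
      (Complex.norm_exp_ofReal_mul_I _) (Complex.norm_exp_ofReal_mul_I _)
    rw [hl, hl, dS_exp _ _ h2.le, dS_exp _ _ h3.le] at g1 g2
    rw [slope_def_field, abs_div, le_div_iff₀ hts, div_le_iff₀ hts]
    constructor
    · refine le_trans ?_ g1
      gcongr
      rw [le_inv_comm₀ (by norm_num) (by linarith)]; norm_num; linarith
    · refine g2.trans ?_
      gcongr; linarith
  exact ⟨ge_of_tendsto ht (ev.mono fun t h => h.1), le_of_tendsto ht (ev.mono fun t h => h.2)⟩

theorem main_pos (Ω : ℂ → ℂ) (ω : ℝ → ℝ) (hω : ContDiff ℝ 1 ω)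
    (hl : ∀ t : ℝ, Ω (Complex.exp ((t : ℂ) * Complex.I)) = Complex.exp ((ω t : ℂ) * Complex.I))
    (h1 : ∀ t, 20/21 ≤ deriv ω t) (h2 : ∀ t, deriv ω t ≤ 21/20)
    (μ : Measure ℂ) [IsLocallyFiniteMeasure μ]
    (C₀ : ℝ) (hC₀ : 0 < C₀) (hreg : Ahlfors1 μ C₀) (hsym : OmegaSym Ω μ) :
    ∃ L : Set ℂ, IsLine L ∧ spt μ ⊆ L := by
  have hk : GoodKer (Kmap Ω) (Complex.exp (-(ω 0 : ℝ) * I)) :=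
    { cont := Kmap_continuous Ω ω hω hl
      nrm := Kmap_norm Ω ω hl
      cd := Kmap_contDiffAt Ω ω hω hl
      fd := fun z hz => ⟨deriv ω (arg z), h1 _, h2 _, Kmap_fderiv Ω ω hω hl z hz⟩
      re := Kmap_re Ω ω hω hl h1 h2
      scal := fun R hR z => Kmap_smul Ω R hR z
      w1 := by rw [← Complex.ofReal_neg]; exact Complex.norm_exp_ofReal_mul_I _ }
  exact main_ker hk hC₀ hreg hsym


/-- The support of an Ahlfors 1-regular, Ω-symmetric measure is
contained in an affine line. -/
theorem stmt_8 (δ : ℝ) (hδ0 : 0 ≤ δ) (hδ1 : δ ≤ 1 / 20)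
    (Ω : ℂ → ℂ) (hmap : MapsCircle Ω) (hodd : OddOnCircle Ω)
    (hbilip : BiLipOnCircle Ω δ) (hC2 : CircleCk Ω 2)
    (μ : Measure ℂ) [IsLocallyFiniteMeasure μ]
    (C₀ : ℝ) (hC₀ : 0 < C₀) (hreg : Ahlfors1 μ C₀)
    (hsym : OmegaSym Ω μ) :
    ∃ L : Set ℂ, IsLine L ∧ spt μ ⊆ L := by
  obtain ⟨ω, hω2, hl⟩ := hC2
  have hω : ContDiff ℝ 1 ω := hω2.of_le (by norm_num)
  have hb := deriv_bounds δ hδ0 hδ1 Ω hbilip ω hω hl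
  have hdc : Continuous (deriv ω) := hω.continuous_deriv le_rfl
  have hnz : ∀ t, deriv ω t ≠ 0 := fun t h => by
    have := (hb t).1
    rw [h] at this; norm_num at this
  rcases lt_or_gt_of_ne (hnz 0) with hneg | hpos
  · have hall : ∀ t, deriv ω t < 0 := by
      intro t
      by_contra hc
      push Not at hc
      obtain ⟨c, hc⟩ := mem_range_of_exists_le_of_exists_ge hdc ⟨0, hneg.le⟩ ⟨t, hc⟩
      exact hnz c hc
    have hl' : ∀ t : ℝ, (fun u => (starRingEnd ℂ) (Ω u)) (Complex.exp ((t : ℂ) * Complex.I)) =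
        Complex.exp ((((fun t => - ω t) t : ℝ) : ℂ) * Complex.I) := by
      intro t
      simp only [hl]
      rw [← Complex.exp_conj]
      simp
    have hd : ∀ t, deriv (fun t => - ω t) t = - deriv ω t := fun t => by simp [deriv.fun_neg]
    refine main_pos (fun u => (starRingEnd ℂ) (Ω u)) (fun t => - ω t) hω.neg hl' ?_ ?_ μ C₀ hC₀ hreg ?_
    · intro t; rw [hd]; have := (hb t).1; rwa [abs_of_neg (hall t)] at this
    · intro t; rw [hd]; have := (hb t).2; rwa [abs_of_neg (hall t)] at this
    · intro x hx r hr
      have e : ∀ z, Kmap (fun u => (starRingEnd ℂ) (Ω u)) z = (starRingEnd ℂ) (Kmap Ω z) := by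
        intro z; simp [Kmap]
      simp_rw [e]
      rw [integral_conj, hsym x hx r hr, map_zero]
  · have hall : ∀ t, 0 < deriv ω t := by
      intro t
      by_contra hc
      push Not at hc
      obtain ⟨c, hc⟩ := mem_range_of_exists_le_of_exists_ge hdc ⟨t, hc⟩ ⟨0, hpos.le⟩
      exact hnz c hc
    refine main_pos Ω ω hω hl ?_ ?_ μ C₀ hC₀ hreg hsym
    · intro t; have := (hb t).1; rwa [abs_of_pos (hall t)] at this
    · intro t; have := (hb t).2; rwa [abs_of_pos (hall t)] at this
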